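/- Under the posterior π(κ | x, τ) ∝ κ^{a-1/2}(1-κ)^{-a-1} L((1/τ²)(1/κ-1)) e^{-κx²/2} on (0,1), if L is bounded above by M > 0, then E(1-κ | x, τ) ≤ (KM/(a(1-a))) e^{x²/2} τ^{2a} (1+o(1)), where the o(1) term is uniform in x and vanishes as τ → 0. -/

import Mathlib

open MeasureTheory Filter Set Topology

/-- The unnormalized posterior density of the shrinkage coefficient `κ ∈ (0,1)`
given observation `x` and global parameter `τ`. -/
noncomputable def postDens (a : ℝ) (L : ℝ → ℝ) (τ x κ : ℝ) : ℝ :=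
  κ ^ (a - 1/2) * (1 - κ) ^ (-a - 1) * L ((1 / τ ^ 2) * (1 / κ - 1)) *
    Real.exp (-(κ * x ^ 2) / 2)

/-- The prior mass function after the substitution `t = (1/κ - 1)/τ²`. -/
noncomputable def priorMass (a : ℝ) (L : ℝ → ℝ) (τ : ℝ) : ℝ :=
  ∫ t in Ioi (0:ℝ), (1 + t * τ ^ 2) ^ (-(1/2) : ℝ) * (t ^ (-a - 1) * L t)

theorem image_inv_one_add_mul {c : ℝ} (hc : 0 < c) :
    (fun t : ℝ => (1 + t * c)⁻¹) '' Ioi 0 = Ioo 0 1 := by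
  ext k
  constructor
  · rintro ⟨t, ht, rfl⟩
    have ht : 0 < t := ht
    have h : 0 < t * c := mul_pos ht hc
    exact ⟨by positivity, inv_lt_one_of_one_lt₀ (by linarith)⟩
  · rintro ⟨h0, h1⟩
    refine ⟨(k⁻¹ - 1) / c, div_pos (by linarith [(one_lt_inv₀ h0).2 h1]) hc, ?_⟩
    have := h0.ne'
    have := hc.ne'
    field_simp
    ring

theorem injOn_inv_one_add_mul {c : ℝ} (hc : 0 < c) :
    InjOn (fun t : ℝ => (1 + t * c)⁻¹) (Ioi 0) := by
  intro s _ t _ h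
  have h' : 1 + s * c = 1 + t * c := inv_injective h
  exact mul_right_cancel₀ hc.ne' (by linarith)

theorem hasDerivAt_inv_one_add_mul {c t : ℝ} (hc : 0 < c) (ht : 0 < t) :
    HasDerivAt (fun t : ℝ => (1 + t * c)⁻¹) (-c / (1 + t * c) ^ 2) t := by
  have h : HasDerivAt (fun t : ℝ => 1 + t * c) c t := by
    simpa using ((hasDerivAt_id t).mul_const c).const_add 1
  exact h.inv (by positivity)

theorem abs_deriv_mul_postDens_zero (a : ℝ) (L : ℝ → ℝ) {τ t : ℝ} (hτ : 0 < τ) (ht : 0 < t) :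
    |-τ ^ 2 / (1 + t * τ ^ 2) ^ 2| • postDens a L τ 0 (1 + t * τ ^ 2)⁻¹ =
      τ ^ (-(2 * a)) * ((1 + t * τ ^ 2) ^ (-(1/2) : ℝ) * (t ^ (-a - 1) * L t)) := by
  have hs : 0 < 1 + t * τ ^ 2 := by positivity
  have harg : (1 / τ ^ 2) * (1 / (1 + t * τ ^ 2)⁻¹ - 1) = t := by
    field_simp
    ring
  have h1 : 1 - (1 + t * τ ^ 2)⁻¹ = t * τ ^ 2 * (1 + t * τ ^ 2)⁻¹ := by
    field_simp
    ring
  have habs : |-τ ^ 2 / (1 + t * τ ^ 2) ^ 2| = τ ^ 2 * (1 + t * τ ^ 2) ^ (-2 : ℝ) := by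
    rw [neg_div, abs_neg, abs_of_pos (by positivity), Real.rpow_neg hs.le, div_eq_mul_inv]
    norm_num
  have hτ2 : (τ ^ 2) ^ (-a - 1) = τ ^ (-(2 * a)) * τ ^ (-2 : ℝ) := by
    rw [← Real.rpow_natCast τ 2, ← Real.rpow_mul hτ.le, ← Real.rpow_add hτ]
    congr 1
    push_cast
    ring
  have hτc : τ ^ 2 * τ ^ (-2 : ℝ) = 1 := by
    rw [Real.rpow_neg hτ.le]
    norm_num
    exact mul_inv_cancel₀ (by positivity)
  have hpow : (1 + t * τ ^ 2) ^ (-2 : ℝ) * ((1 + t * τ ^ 2) ^ (-(a - 1/2)) *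
      (1 + t * τ ^ 2) ^ (-(-a - 1))) = (1 + t * τ ^ 2) ^ (-(1/2) : ℝ) := by
    rw [← Real.rpow_add hs, ← Real.rpow_add hs]
    congr 1
    ring
  rw [postDens, harg, h1, habs, Real.mul_rpow (by positivity) (by positivity),
    Real.mul_rpow ht.le (by positivity), hτ2, Real.inv_rpow hs.le, Real.inv_rpow hs.le,
    ← Real.rpow_neg hs.le, ← Real.rpow_neg hs.le, ← hpow, smul_eq_mul]
  simp only [ne_eq, OfNat.ofNat_ne_zero, not_false_eq_true, zero_pow, mul_zero, neg_zero, zero_div,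
    Real.exp_zero, mul_one]
  linear_combination ((1 + t * τ ^ 2) ^ (-2 : ℝ) * ((1 + t * τ ^ 2) ^ (-(a - 1/2)) *
      (1 + t * τ ^ 2) ^ (-(-a - 1))) * t ^ (-a - 1) * L t * τ ^ (-(2 * a))) * hτc

theorem integral_postDens_zero (a : ℝ) (L : ℝ → ℝ) {τ : ℝ} (hτ : 0 < τ) :
    ∫ κ in Ioo (0:ℝ) 1, postDens a L τ 0 κ = τ ^ (-(2 * a)) * priorMass a L τ := by
  have hc : 0 < τ ^ 2 := by positivity
  rw [← image_inv_one_add_mul hc, integral_image_eq_integral_abs_deriv_smul measurableSet_Ioi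
    (fun t ht => (hasDerivAt_inv_one_add_mul hc ht).hasDerivWithinAt)
    (injOn_inv_one_add_mul hc), priorMass, ← integral_const_mul]
  exact setIntegral_congr_fun measurableSet_Ioi
    fun t ht => abs_deriv_mul_postDens_zero a L hτ ht

theorem norm_priorMass_integrand_le {a τ t : ℝ} (L : ℝ → ℝ) (ht : 0 < t) :
    ‖(1 + t * τ ^ 2) ^ (-(1/2) : ℝ) * (t ^ (-a - 1) * L t)‖ ≤ ‖t ^ (-a - 1) * L t‖ := by
  rw [norm_mul]
  refine mul_le_of_le_one_left (norm_nonneg _) ?_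
  have hs : 1 ≤ 1 + t * τ ^ 2 := le_add_of_nonneg_right (by positivity)
  rw [Real.norm_of_nonneg (by positivity)]
  exact Real.rpow_le_one_of_one_le_of_nonpos hs (by norm_num)

theorem integrableOn_priorMass_integrand {a : ℝ} {L : ℝ → ℝ} (hL : Measurable L)
    (hint : IntegrableOn (fun t => t ^ (-a - 1) * L t) (Ioi 0)) (τ : ℝ) :
    IntegrableOn (fun t => (1 + t * τ ^ 2) ^ (-(1/2) : ℝ) * (t ^ (-a - 1) * L t)) (Ioi 0) :=
  Integrable.mono hint (by fun_prop)
    ((ae_restrict_mem measurableSet_Ioi).mono fun _ ht => norm_priorMass_integrand_le L ht)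

theorem integrableOn_postDens_zero {a : ℝ} {L : ℝ → ℝ} (hL : Measurable L)
    (hint : IntegrableOn (fun t => t ^ (-a - 1) * L t) (Ioi 0)) {τ : ℝ} (hτ : 0 < τ) :
    IntegrableOn (postDens a L τ 0) (Ioo 0 1) := by
  have hc : 0 < τ ^ 2 := by positivity
  rw [← image_inv_one_add_mul hc, integrableOn_image_iff_integrableOn_abs_deriv_smul
    measurableSet_Ioi (fun t ht => (hasDerivAt_inv_one_add_mul hc ht).hasDerivWithinAt)
    (injOn_inv_one_add_mul hc)]
  exact IntegrableOn.congr_fun ((integrableOn_priorMass_integrand hL hint τ).const_mul _)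
    (fun t ht => (abs_deriv_mul_postDens_zero a L hτ ht).symm) measurableSet_Ioi

theorem priorMass_pos {a : ℝ} {L : ℝ → ℝ} (hL : Measurable L) (hLpos : ∀ t > 0, 0 < L t)
    (hint : IntegrableOn (fun t => t ^ (-a - 1) * L t) (Ioi 0)) (τ : ℝ) :
    0 < priorMass a L τ := by
  have hpos : ∀ t ∈ Ioi (0:ℝ), 0 < (1 + t * τ ^ 2) ^ (-(1/2) : ℝ) * (t ^ (-a - 1) * L t) := by
    intro t ht
    have ht : 0 < t := ht
    have := hLpos t ht
    positivity
  rw [priorMass, setIntegral_pos_iff_support_of_nonneg_ae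
    ((ae_restrict_mem measurableSet_Ioi).mono fun t ht => (hpos t ht).le)
    (integrableOn_priorMass_integrand hL hint τ),
    inter_eq_self_of_subset_right fun t ht => Function.mem_support.2 (hpos t ht).ne']
  simp

theorem tendsto_priorMass {a : ℝ} {L : ℝ → ℝ} (hL : Measurable L)
    (hint : IntegrableOn (fun t => t ^ (-a - 1) * L t) (Ioi 0)) :
    Tendsto (priorMass a L) (𝓝 0) (𝓝 (∫ t in Ioi (0:ℝ), t ^ (-a - 1) * L t)) := by
  refine tendsto_integral_filter_of_dominated_convergence (fun t => ‖t ^ (-a - 1) * L t‖)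
    (Eventually.of_forall fun τ => (integrableOn_priorMass_integrand hL hint τ).1)
    (Eventually.of_forall fun τ => (ae_restrict_mem measurableSet_Ioi).mono
      fun _ ht => norm_priorMass_integrand_le L ht) hint.norm (Eventually.of_forall fun t => ?_)
  have h : ContinuousAt (fun τ : ℝ => (1 + t * τ ^ 2) ^ (-(1/2) : ℝ) * (t ^ (-a - 1) * L t)) 0 :=
    (ContinuousAt.rpow_const (by fun_prop) (by simp)).mul continuousAt_const
  simpa [ContinuousAt] using h

theorem postDens_nonneg (a : ℝ) {L : ℝ → ℝ} (hLpos : ∀ t > 0, 0 < L t) {τ κ : ℝ} (hτ : 0 < τ)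
    (x : ℝ) (hκ : κ ∈ Ioo (0:ℝ) 1) : 0 ≤ postDens a L τ x κ := by
  obtain ⟨h0, h1⟩ := hκ
  have hL := hLpos ((1 / τ ^ 2) * (1 / κ - 1))
    (mul_pos (by positivity) (by linarith [one_lt_one_div h0 h1]))
  have : 0 < 1 - κ := by linarith
  unfold postDens
  positivity

theorem postDens_eq_postDens_zero_mul (a : ℝ) (L : ℝ → ℝ) (τ x κ : ℝ) :
    postDens a L τ x κ = postDens a L τ 0 κ * Real.exp (-(κ * x ^ 2) / 2) := by
  simp [postDens]

theorem measurable_postDens (a : ℝ) {L : ℝ → ℝ} (hL : Measurable L) (τ x : ℝ) :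
    Measurable (postDens a L τ x) := by
  unfold postDens
  fun_prop

theorem exp_mul_priorMass_le_integral_postDens {a : ℝ} {L : ℝ → ℝ} (hL : Measurable L)
    (hLpos : ∀ t > 0, 0 < L t) (hint : IntegrableOn (fun t => t ^ (-a - 1) * L t) (Ioi 0))
    {τ : ℝ} (hτ : 0 < τ) (x : ℝ) :
    Real.exp (-(x ^ 2 / 2)) * (τ ^ (-(2 * a)) * priorMass a L τ) ≤
      ∫ κ in Ioo (0:ℝ) 1, postDens a L τ x κ := by
  have h0 := integrableOn_postDens_zero hL hint hτ
  rw [← integral_postDens_zero a L hτ, ← integral_const_mul]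
  refine setIntegral_mono_on (h0.const_mul _) (Integrable.mono h0
    (measurable_postDens a hL τ x).aestronglyMeasurable
    ((ae_restrict_mem measurableSet_Ioo).mono fun κ hκ => ?_)) measurableSet_Ioo fun κ hκ => ?_
  · rw [postDens_eq_postDens_zero_mul, norm_mul]
    refine mul_le_of_le_one_right (norm_nonneg _) ?_
    rw [Real.norm_of_nonneg (Real.exp_pos _).le, Real.exp_le_one_iff]
    nlinarith [mul_nonneg hκ.1.le (sq_nonneg x)]
  · rw [postDens_eq_postDens_zero_mul a L τ x, mul_comm]
    refine mul_le_mul_of_nonneg_left (Real.exp_le_exp.2 ?_) (postDens_nonneg a hLpos hτ 0 hκ)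
    nlinarith [mul_nonneg (sub_nonneg.2 hκ.2.le) (sq_nonneg x)]

theorem one_sub_mul_postDens_le {a M : ℝ} (ha : a ∈ Ioo (0:ℝ) 1) (hM : 0 < M) {L : ℝ → ℝ}
    (hLpos : ∀ t > 0, 0 < L t) (hLbdd : ∀ t > 0, L t ≤ M) {τ κ : ℝ} (hτ : 0 < τ) (x : ℝ)
    (hκ : κ ∈ Ioo (0:ℝ) 1) :
    (1 - κ) * postDens a L τ x κ ≤ M * ((1 - κ) ^ (-a) + κ ^ (a - 1)) := by
  obtain ⟨h0, h1⟩ := hκ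
  obtain ⟨ha0, ha1⟩ := ha
  have hk : 0 < 1 - κ := by linarith
  have harg : 0 < (1 / τ ^ 2) * (1 / κ - 1) :=
    mul_pos (by positivity) (by linarith [one_lt_one_div h0 h1])
  have hL0 := (hLpos _ harg).le
  have hLM := hLbdd _ harg
  have hexp : Real.exp (-(κ * x ^ 2) / 2) ≤ 1 := by
    rw [Real.exp_le_one_iff]
    nlinarith [mul_nonneg h0.le (sq_nonneg x)]
  have hone : (1 - κ) * (1 - κ) ^ (-a - 1) = (1 - κ) ^ (-a) := by
    rw [mul_comm, ← Real.rpow_add_one hk.ne']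
    congr 1
    ring
  have hκa : κ * κ ^ (a - 1) = κ ^ a := by
    rw [mul_comm, ← Real.rpow_add_one h0.ne']
    congr 1
    ring
  have hka : (1 - κ) * (1 - κ) ^ (-a) = (1 - κ) ^ (1 - a) := by
    rw [mul_comm, ← Real.rpow_add_one hk.ne']
    congr 1
    ring
  have hhalf : κ ^ (a - 1/2) ≤ κ ^ (a - 1) :=
    Real.rpow_le_rpow_of_exponent_ge h0 h1.le (by linarith)
  have hsplit : κ ^ (a - 1) * (1 - κ) ^ (-a) ≤ (1 - κ) ^ (-a) + κ ^ (a - 1) := by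
    have e1 : κ ^ a * (1 - κ) ^ (-a) ≤ (1 - κ) ^ (-a) :=
      mul_le_of_le_one_left (by positivity) (Real.rpow_le_one h0.le h1.le ha0.le)
    have e2 : κ ^ (a - 1) * (1 - κ) ^ (1 - a) ≤ κ ^ (a - 1) :=
      mul_le_of_le_one_right (by positivity) (Real.rpow_le_one hk.le (by linarith) (by linarith))
    calc κ ^ (a - 1) * (1 - κ) ^ (-a)
        = κ ^ a * (1 - κ) ^ (-a) + κ ^ (a - 1) * (1 - κ) ^ (1 - a) := by
          rw [← hκa, ← hka]
          ring
      _ ≤ _ := add_le_add e1 e2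
  calc (1 - κ) * postDens a L τ x κ
      = κ ^ (a - 1/2) * (1 - κ) ^ (-a) * L ((1 / τ ^ 2) * (1 / κ - 1)) *
          Real.exp (-(κ * x ^ 2) / 2) := by
        rw [postDens, ← hone]
        ring
    _ ≤ κ ^ (a - 1) * (1 - κ) ^ (-a) * M * 1 := by gcongr
    _ = M * (κ ^ (a - 1) * (1 - κ) ^ (-a)) := by ring
    _ ≤ _ := by gcongr

theorem intervalIntegrable_one_sub_rpow_and_rpow {a : ℝ} (ha : a ∈ Ioo (0:ℝ) 1) :
    IntervalIntegrable (fun κ : ℝ => (1 - κ) ^ (-a)) volume 0 1 ∧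
      IntervalIntegrable (fun κ : ℝ => κ ^ (a - 1)) volume 0 1 := by
  refine ⟨?_, intervalIntegral.intervalIntegrable_rpow' (by linarith [ha.1])⟩
  have h := (intervalIntegral.intervalIntegrable_rpow' (a := 0) (b := 1) (r := -a)
    (by linarith [ha.2])).comp_sub_left 1
  simpa using h.symm

theorem integral_one_sub_rpow_add_rpow {a : ℝ} (ha : a ∈ Ioo (0:ℝ) 1) :
    ∫ κ in Ioo (0:ℝ) 1, ((1 - κ) ^ (-a) + κ ^ (a - 1)) = 1 / (a * (1 - a)) := by
  obtain ⟨h1, h2⟩ := intervalIntegrable_one_sub_rpow_and_rpow ha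
  obtain ⟨ha0, ha1⟩ := ha
  have e : ∫ κ in (0:ℝ)..1, (1 - κ) ^ (-a) = 1 / (1 - a) := by
    rw [intervalIntegral.integral_comp_sub_left (fun κ : ℝ => κ ^ (-a)) 1]
    simp only [sub_self, sub_zero]
    rw [integral_rpow (Or.inl (by linarith)), Real.one_rpow, Real.zero_rpow (by linarith), sub_zero,
      neg_add_eq_sub]
  rw [← integral_Ioc_eq_integral_Ioo, ← intervalIntegral.integral_of_le zero_le_one,
    intervalIntegral.integral_add h1 h2, e, integral_rpow (Or.inl (by linarith)), Real.one_rpow,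
    Real.zero_rpow (by linarith), sub_zero, sub_add_cancel]
  have : 1 - a ≠ 0 := by linarith
  field_simp
  ring

theorem integral_one_sub_mul_postDens_le {a M : ℝ} (ha : a ∈ Ioo (0:ℝ) 1) (hM : 0 < M)
    {L : ℝ → ℝ} (hLpos : ∀ t > 0, 0 < L t) (hLbdd : ∀ t > 0, L t ≤ M) {τ : ℝ} (hτ : 0 < τ)
    (x : ℝ) :
    ∫ κ in Ioo (0:ℝ) 1, (1 - κ) * postDens a L τ x κ ≤ M / (a * (1 - a)) := by
  have hint : IntegrableOn (fun κ : ℝ => (1 - κ) ^ (-a) + κ ^ (a - 1)) (Ioo 0 1) := by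
    obtain ⟨h1, h2⟩ := intervalIntegrable_one_sub_rpow_and_rpow ha
    exact (intervalIntegrable_iff_integrableOn_Ioo_of_le zero_le_one).1 (h1.add h2)
  have hae := ae_restrict_mem (μ := volume) (measurableSet_Ioo (a := (0:ℝ)) (b := 1))
  calc ∫ κ in Ioo (0:ℝ) 1, (1 - κ) * postDens a L τ x κ
      ≤ ∫ κ in Ioo (0:ℝ) 1, M * ((1 - κ) ^ (-a) + κ ^ (a - 1)) :=
        integral_mono_of_nonneg
          (hae.mono fun κ hκ => mul_nonneg (sub_nonneg.2 hκ.2.le) (postDens_nonneg a hLpos hτ x hκ))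
          (hint.const_mul M)
          (hae.mono fun κ hκ => one_sub_mul_postDens_le ha hM hLpos hLbdd hτ x hκ)
    _ = M / (a * (1 - a)) := by
        rw [integral_const_mul, integral_one_sub_rpow_add_rpow ha, mul_one_div]

/-- If `L ≤ M` on `(0,∞)` and `a ∈ (0,1)`, then
`E(1-κ | x, τ) ≤ (KM/(a(1-a))) e^{x²/2} τ^{2a} (1+o(1))`,
the `o(1)` term being uniform in `x` and vanishing as `τ → 0⁺`. -/
theorem posterior_mean_bound_bounded (a K M : ℝ) (ha : a ∈ Ioo (0:ℝ) 1)
    (hK : 0 < K) (hM : 0 < M) (L : ℝ → ℝ)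
    (hLmeas : Measurable L)
    (hLpos : ∀ t > 0, 0 < L t)
    (hslow : ∀ c > 0, Tendsto (fun x => L (c * x) / L x) atTop (𝓝 1))
    (hLbdd : ∀ t > 0, L t ≤ M)
    (hnorm : K * ∫ t in Ioi (0:ℝ), t ^ (-a - 1) * L t = 1) :
    ∃ g : ℝ → ℝ, Tendsto g (𝓝[>] 0) (𝓝 0) ∧
      ∀ τ > 0, ∀ x : ℝ,
        (∫ κ in Ioo (0:ℝ) 1, (1 - κ) * postDens a L τ x κ) /
            (∫ κ in Ioo (0:ℝ) 1, postDens a L τ x κ) ≤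
          (K * M / (a * (1 - a))) * Real.exp (x ^ 2 / 2) * τ ^ (2 * a) *
            (1 + g τ) := by
  have hI : ∫ t in Ioi (0:ℝ), t ^ (-a - 1) * L t ≠ 0 := by
    intro h
    simp [h] at hnorm
  have hint : IntegrableOn (fun t => t ^ (-a - 1) * L t) (Ioi 0) := by
    by_contra h
    exact hI (integral_undef h)
  refine ⟨fun τ => 1 / (K * priorMass a L τ) - 1, ?_, fun τ hτ x => ?_⟩
  · have h := (((tendsto_priorMass hLmeas hint).mono_left
      (nhdsWithin_le_nhds (s := Ioi 0))).const_mul K)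
    rw [hnorm] at h
    simpa using (h.inv₀ one_ne_zero).sub_const 1
  · have hJ := priorMass_pos hLmeas hLpos hint τ
    have hτp : 0 < τ ^ (2 * a) := Real.rpow_pos_of_pos hτ _
    have ha' : 0 < a * (1 - a) := mul_pos ha.1 (sub_pos.2 ha.2)
    have hden := exp_mul_priorMass_le_integral_postDens hLmeas hLpos hint hτ x
    rw [Real.exp_neg, Real.rpow_neg hτ.le] at hden
    calc _ ≤ M / (a * (1 - a)) /
          ((Real.exp (x ^ 2 / 2))⁻¹ * ((τ ^ (2 * a))⁻¹ * priorMass a L τ)) :=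
          div_le_div₀ (by positivity)
            (integral_one_sub_mul_postDens_le ha hM hLpos hLbdd hτ x) (by positivity) hden
      _ = _ := by
          have h1a : 1 - a ≠ 0 := (sub_pos.2 ha.2).ne'
          have h0a : a ≠ 0 := ha.1.ne'
          rw [add_sub_cancel]
          field_simp
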